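/- arXiv:1603.05475 — 2 statements merged into one kernel-verified Lean document; each statement's English description precedes it below -/
import Mathlib

section
/- For every real number x > 0, the sum over all integers n of 1/(1+(n/x)^2) equals π x coth(π x). -/
theorem sum_inv_one_add_sq_eq_pi_mul_coth {x : ℝ} (hx : 0 < x) :
    ∑' n : ℤ, 1 / (1 + ((n : ℝ) / x) ^ 2) =
      Real.pi * x * (Real.cosh (Real.pi * x) / Real.sinh (Real.pi * x)) := by
  have hz : (Complex.I * x : ℂ) ∈ Complex.integerComplement := by
    rintro ⟨n, hn⟩
    have := congrArg Complex.im hn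
    simp at this
    exact hx.ne this
  have hx0 : (x : ℂ) ≠ 0 := by exact_mod_cast hx.ne'
  have hs : Real.sinh (Real.pi * x) ≠ 0 := by
    have : 0 < Real.sinh (Real.pi * x) := Real.sinh_pos_iff.2 (by positivity)
    exact this.ne'
  have hterm : ∀ n : ℕ, Complex.I * x * (1 / (Complex.I * x - (n + 1)) +
      1 / (Complex.I * x + (n + 1))) =
      ((2 * (1 / (1 + (((n : ℝ) + 1) / x) ^ 2)) : ℝ) : ℂ) := by
    intro n
    have h1 : (Complex.I * x - (n + 1) : ℂ) ≠ 0 := by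
      intro h
      have := congrArg Complex.im h
      simp at this
      exact hx.ne' this
    have h2 : (Complex.I * x + (n + 1) : ℂ) ≠ 0 := by
      intro h
      have := congrArg Complex.im h
      simp at this
      exact hx.ne' this
    have h3 : ((x : ℂ) ^ 2 + (n + 1) ^ 2 : ℂ) ≠ 0 := by
      have : x ^ 2 + ((n : ℝ) + 1) ^ 2 ≠ 0 := by positivity
      exact_mod_cast this
    have e : (1 + (((n : ℂ) + 1) / x) ^ 2) = ((x : ℂ) ^ 2 + (n + 1) ^ 2) / x ^ 2 := by
      field_simp
    push_cast
    rw [e]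
    have e2 : ((x : ℂ) ^ 2 + (n + 1) ^ 2) =
        - ((Complex.I * x - (n + 1)) * (Complex.I * x + (n + 1))) := by
      linear_combination ((x : ℂ) ^ 2) * Complex.I_sq
    rw [e2]
    field_simp
    linear_combination (2 * (x : ℂ)) * Complex.I_sq
  have hS : HasSum (fun n : ℕ => (1 / (Complex.I * x - (n + 1)) +
      1 / (Complex.I * x + (n + 1)) : ℂ))
      (Real.pi * Complex.cot (Real.pi * (Complex.I * x)) - 1 / (Complex.I * x)) := by
    rw [cot_series_rep' hz]
    exact (summable_cotTerm hz).hasSum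
  have hS2 := hS.mul_left (Complex.I * x : ℂ)
  simp_rw [hterm] at hS2
  have hval : Complex.I * x * (Real.pi * Complex.cot (Real.pi * (Complex.I * x)) -
      1 / (Complex.I * x)) =
      ((Real.pi * x * (Real.cosh (Real.pi * x) / Real.sinh (Real.pi * x)) - 1 : ℝ) : ℂ) := by
    have e : (Real.pi * (Complex.I * x) : ℂ) = (Real.pi * x : ℂ) * Complex.I := by ring
    have hs' : Complex.sinh (Real.pi * x) ≠ 0 := by exact_mod_cast hs
    rw [e, Complex.cot, Complex.cos_mul_I, Complex.sin_mul_I]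
    push_cast
    field_simp
  rw [hval] at hS2
  have hS3 := (Complex.hasSum_ofReal.1 hS2).mul_left (1 / 2)
  have hS4 : HasSum (fun n : ℕ => 1 / (1 + (((n : ℝ) + 1) / x) ^ 2)) (1 / 2 *
      (Real.pi * x * (Real.cosh (Real.pi * x) / Real.sinh (Real.pi * x)) - 1)) := by
    have e : (fun n : ℕ => 1 / (1 + (((n : ℝ) + 1) / x) ^ 2)) =
        fun n : ℕ => 1 / 2 * (2 * (1 / (1 + (((n : ℝ) + 1) / x) ^ 2))) := by
      funext n
      ring
    rw [e]
    exact hS3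
  have key := HasSum.of_add_one_of_neg_add_one (f := fun n : ℤ => 1 / (1 + ((n : ℝ) / x) ^ 2))
    (by simpa using hS4)
    (by
      convert hS4 using 2 with n
      push_cast
      ring)
  rw [key.tsum_eq]
  simp
  ring
end

section
/- There exists a constant C > 0 such that for every real number α and every real T, ∫_T^{T+1} |Re(g'(it)/g(it))| dt ≤ C, where g(s) = Γ_ℝ(s+α)/Γ_ℝ(s+1+α) and Γ_ℝ(s) = π^{-s/2} Γ(s/2); here the integral is over those t for which g(it) is defined and nonzero (g has no zeros or poles on the line Re s = 0 unless α is an integer, in which case the integrand has an integrable singularity and the estimate still holds). -/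
open Complex

/-- The half-step difference of the digamma function. -/
noncomputable def digDiff (w : ℂ) : ℂ := digamma (w + 1 / 2) - digamma w

/-- Terms of the series for `digDiff`. -/
noncomputable def digTerm (k : ℕ) (w : ℂ) : ℂ := (w + k)⁻¹ - (w + k + 1 / 2)⁻¹

/-- Away from the poles. -/
def NoPole (w : ℂ) : Prop := ∀ m : ℕ, w ≠ -m

lemma noPole_of_re_pos {w : ℂ} (h : 0 < w.re) : NoPole w := by
  intro m hm
  rw [hm] at h
  simp at h
  have : (0 : ℝ) ≤ m := m.cast_nonneg
  linarith

lemma noPole_of_im {w : ℂ} (h : w.im ≠ 0) : NoPole w := by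
  intro m hm
  rw [hm] at h
  simp at h

lemma NoPole.add_one {w : ℂ} (h : NoPole w) : NoPole (w + 1) := by
  intro m hm
  apply h (m + 1)
  push_cast
  linear_combination hm

lemma digDiff_step {w : ℂ} (h1 : NoPole w) (h2 : NoPole (w + 1 / 2)) :
    digDiff w = (w⁻¹ - (w + 1 / 2)⁻¹) + digDiff (w + 1) := by
  have e1 := digamma_apply_add_one w h1
  have e2 := digamma_apply_add_one (w + 1 / 2) h2
  have e3 : w + 1 + 1 / 2 = w + 1 / 2 + 1 := by ring
  unfold digDiff
  rw [e3, e1, e2]; ring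

lemma digDiff_iter {w : ℂ} (h1 : NoPole w) (h2 : NoPole (w + 1 / 2)) (N : ℕ) :
    digDiff w = ∑ k ∈ Finset.range N, digTerm k w + digDiff (w + N) := by
  have key : ∀ N : ℕ, NoPole (w + N) ∧ NoPole (w + N + 1 / 2) ∧
      digDiff w = ∑ k ∈ Finset.range N, digTerm k w + digDiff (w + N) := by
    intro N
    induction N with
    | zero => simpa using ⟨h1, by simpa using h2⟩
    | succ n ih =>
      obtain ⟨a, b, c⟩ := ih
      refine ⟨?_, ?_, ?_⟩
      · have := a.add_one
        push_cast
        rwa [← add_assoc]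
      · have := b.add_one
        push_cast
        rwa [show w + (n + 1) + 1 / 2 = w + n + 1 / 2 + 1 by ring]
      · rw [Finset.sum_range_succ, c, digDiff_step a b]
        push_cast
        unfold digTerm
        rw [← add_assoc w]; ring
  exact (key N).2.2

lemma digamma_ofReal {x : ℝ} (hx : 0 < x) :
    digamma (x : ℂ) = ((deriv (Real.log ∘ Real.Gamma) x : ℝ) : ℂ) := by
  have hd : DifferentiableAt ℝ Real.Gamma x := Real.differentiableAt_Gamma (by
    intro m hm
    have : (0 : ℝ) ≤ m := m.cast_nonneg
    linarith)
  have hG := Real.Gamma_pos_of_pos hx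
  have h1 : deriv (Real.log ∘ Real.Gamma) x = deriv Real.Gamma x / Real.Gamma x :=
    (hd.hasDerivAt.log hG.ne').deriv
  have h2 := (differentiableAt_Gamma (x : ℂ)
    (noPole_of_re_pos (by simpa using hx))).hasDerivAt.comp_ofReal
  have h3 := hd.hasDerivAt.ofReal_comp
  simp only [Complex.Gamma_ofReal] at h2
  have h4 := h2.unique h3
  rw [h1, digamma_def, logDeriv_apply, h4, Complex.Gamma_ofReal]
  push_cast; rfl

lemma norm_digDiff_ofReal {x : ℝ} (hx : 0 < x) : ‖digDiff (x : ℂ)‖ ≤ 1 / x := by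
  have hmono := Real.convexOn_log_Gamma.monotoneOn_deriv (by
    intro y hy
    have hy' : 0 < y := hy
    exact (Real.differentiableAt_Gamma (by
      intro m hm
      have : (0 : ℝ) ≤ m := m.cast_nonneg
      linarith)).log (Real.Gamma_pos_of_pos hy').ne')
  have e0 := digamma_ofReal hx
  have e1 := digamma_ofReal (x := x + 1 / 2) (by linarith)
  have e2 := digamma_ofReal (x := x + 1) (by linarith)
  have m1 := hmono (a := x) (b := x + 1 / 2) hx (by simp; linarith) (by linarith)
  have m2 := hmono (a := x + 1 / 2) (b := x + 1) (by simp; linarith) (by simp; linarith)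
    (by linarith)
  have s := digamma_apply_add_one (x : ℂ) (noPole_of_re_pos (by simpa using hx))
  have s' : deriv (Real.log ∘ Real.Gamma) (x + 1) = deriv (Real.log ∘ Real.Gamma) x + x⁻¹ := by
    have : (x : ℂ) + 1 = ((x + 1 : ℝ) : ℂ) := by push_cast; ring
    rw [this, e2, e0] at s
    exact_mod_cast s
  have : digDiff (x : ℂ) = ((deriv (Real.log ∘ Real.Gamma) (x + 1 / 2)
      - deriv (Real.log ∘ Real.Gamma) x : ℝ) : ℂ) := by
    unfold digDiff
    rw [show (x : ℂ) + 1 / 2 = ((x + 1 / 2 : ℝ) : ℂ) by push_cast; ring, e1, e0]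
    push_cast; ring
  rw [this, Complex.norm_real, Real.norm_eq_abs, abs_of_nonneg (by linarith), one_div x]
  linarith

lemma abs_re_le_norm' (w : ℂ) : w.re ≤ ‖w‖ := (le_abs_self _).trans (Complex.abs_re_le_norm w)

lemma norm_digTerm_le {k : ℕ} {w : ℂ} {A : ℝ} (hA : 0 < A) (h1 : A ≤ |w.re + k|)
    (h2 : A ≤ |w.re + k + 1 / 2|) : ‖digTerm k w‖ ≤ (1 / 2) / A ^ 2 := by
  have n1 : A ≤ ‖w + k‖ := h1.trans (by simpa using Complex.abs_re_le_norm (w + k))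
  have n2 : A ≤ ‖w + k + 1 / 2‖ := h2.trans (by
    have := Complex.abs_re_le_norm (w + k + 1 / 2)
    simpa using this)
  have z1 : w + k ≠ 0 := norm_pos_iff.1 (hA.trans_le n1)
  have z2 : w + k + 1 / 2 ≠ 0 := norm_pos_iff.1 (hA.trans_le n2)
  have e : digTerm k w = (1 / 2) / ((w + k) * (w + k + 1 / 2)) := by
    unfold digTerm
    rw [inv_sub_inv z1 z2]; congr 1; ring
  rw [e, norm_div, norm_mul]
  have : ‖(1 / 2 : ℂ)‖ = 1 / 2 := by simp
  rw [this, pow_two]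
  gcongr

lemma norm_digTerm_le_of_re {k : ℕ} {w : ℂ} (h : 1 < w.re) :
    ‖digTerm k w‖ ≤ (1 / 2) / ((k : ℝ) + 1) ^ 2 := by
  have hk : (0 : ℝ) ≤ k := k.cast_nonneg
  apply norm_digTerm_le (by linarith)
  · rw [abs_of_nonneg (by linarith)]; linarith
  · rw [abs_of_nonneg (by linarith)]; linarith

lemma summable_bound : Summable fun k : ℕ => (1 / 2 : ℝ) / ((k : ℝ) + 1) ^ 2 := by
  have h := (summable_nat_add_iff 1).2 (Real.summable_one_div_nat_pow.2 (one_lt_two))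
  have := h.mul_left (1 / 2 : ℝ)
  refine this.congr fun k => ?_
  push_cast; ring

lemma digDiff_eq_tsum_ofReal {x : ℝ} (hx : 1 < x) :
    digDiff (x : ℂ) = ∑' k, digTerm k (x : ℂ) := by
  have hs : Summable fun k => digTerm k (x : ℂ) :=
    Summable.of_norm_bounded summable_bound fun k => norm_digTerm_le_of_re (by simpa using hx)
  have t1 := hs.hasSum.tendsto_sum_nat
  have h0 : Filter.Tendsto (fun N : ℕ => digDiff ((x : ℂ) + N)) Filter.atTop (nhds 0) := by
    apply squeeze_zero_norm (a := fun N : ℕ => 1 / ((N : ℝ) + 1))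
    · intro N
      have hN : (0 : ℝ) ≤ N := N.cast_nonneg
      have := norm_digDiff_ofReal (x := x + N) (by linarith)
      push_cast at this
      refine this.trans ?_
      gcongr 1 / ?_
      linarith
    · exact tendsto_one_div_add_atTop_nhds_zero_nat
  have t2 := t1.add h0
  rw [add_zero] at t2
  refine tendsto_nhds_unique ?_ t2
  have : ∀ N : ℕ, ∑ k ∈ Finset.range N, digTerm k (x : ℂ) + digDiff ((x : ℂ) + N)
      = digDiff (x : ℂ) := fun N => (digDiff_iter (noPole_of_re_pos (by simp; linarith))
        (noPole_of_re_pos (by simp; linarith)) N).symm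
  simp_rw [this]
  exact tendsto_const_nhds

lemma differentiableAt_digamma {w : ℂ} (h : 0 < w.re) : DifferentiableAt ℂ digamma w := by
  have ho : IsOpen {z : ℂ | 0 < z.re} := isOpen_lt continuous_const Complex.continuous_re
  have hd : DifferentiableOn ℂ Gamma {z : ℂ | 0 < z.re} := fun z hz =>
    (differentiableAt_Gamma z (noPole_of_re_pos hz)).differentiableWithinAt
  have hd' := (hd.deriv ho).differentiableAt (ho.mem_nhds h)
  exact hd'.div (hd.differentiableAt (ho.mem_nhds h)) (Gamma_ne_zero_of_re_pos h)

lemma digDiff_eq_tsum {w : ℂ} (hw : 1 < w.re) : digDiff w = ∑' k, digTerm k w := by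
  have ho : IsOpen {z : ℂ | 1 < z.re} := isOpen_lt continuous_const Complex.continuous_re
  have hf : AnalyticOnNhd ℂ digDiff {z : ℂ | 1 < z.re} := by
    refine DifferentiableOn.analyticOnNhd (fun z hz => ?_) ho
    have hz' : 1 < z.re := hz
    refine DifferentiableAt.differentiableWithinAt ?_
    refine DifferentiableAt.sub ?_ (differentiableAt_digamma (by linarith))
    exact DifferentiableAt.comp z (differentiableAt_digamma (by simp; linarith))
      (by fun_prop : DifferentiableAt ℂ (fun z : ℂ => z + 1 / 2) z)
  have hg : AnalyticOnNhd ℂ (fun w => ∑' k, digTerm k w) {z : ℂ | 1 < z.re} := by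
    refine DifferentiableOn.analyticOnNhd ?_ ho
    refine differentiableOn_tsum_of_summable_norm summable_bound (fun k z hz => ?_) ho
      (fun k z hz => norm_digTerm_le_of_re hz)
    have hz' : 1 < z.re := hz
    have hk : (0 : ℝ) ≤ k := k.cast_nonneg
    have z1 : z + k ≠ 0 := fun h => by
      have := congrArg Complex.re h
      simp at this; linarith
    have z2 : z + k + 1 / 2 ≠ 0 := fun h => by
      have := congrArg Complex.re h
      simp at this; linarith
    unfold digTerm
    refine DifferentiableAt.differentiableWithinAt ?_
    exact ((by fun_prop : DifferentiableAt ℂ (fun z : ℂ => z + k) z).inv z1).sub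
      ((by fun_prop : DifferentiableAt ℂ (fun z : ℂ => z + k + 1 / 2) z).inv z2)
  refine hf.eqOn_of_preconnected_of_frequently_eq hg
    (convex_halfSpace_re_gt 1).isPreconnected (z₀ := ((2 : ℝ) : ℂ)) (by simp) ?_ hw
  have ht : Filter.Tendsto (fun x : ℝ => (x : ℂ)) (nhdsWithin 2 {2}ᶜ)
      (nhdsWithin ((2 : ℝ) : ℂ) {((2 : ℝ) : ℂ)}ᶜ) := by
    refine tendsto_nhdsWithin_iff.2 ⟨?_, ?_⟩
    · exact (Complex.continuous_ofReal.tendsto 2).mono_left nhdsWithin_le_nhds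
    · filter_upwards [self_mem_nhdsWithin] with x hx
      simp only [Set.mem_compl_iff, Set.mem_singleton_iff] at hx ⊢
      exact_mod_cast hx
  refine ht.frequently (Filter.Eventually.frequently ?_)
  have : ∀ᶠ x : ℝ in nhdsWithin 2 {2}ᶜ, 1 < x :=
    nhdsWithin_le_nhds (lt_mem_nhds (by norm_num))
  filter_upwards [this] with x hx
  exact digDiff_eq_tsum_ofReal hx

lemma norm_digDiff_le {w : ℂ} (hw : 1 < w.re) :
    ‖digDiff w‖ ≤ ∑' k : ℕ, (1 / 2 : ℝ) / ((k : ℝ) + 1) ^ 2 := by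
  rw [digDiff_eq_tsum hw]
  exact tsum_of_norm_bounded summable_bound.hasSum fun k => norm_digTerm_le_of_re hw

lemma sum_shift_le {f : ℤ → ℝ} (h0 : ∀ i, 0 ≤ f i) (hf : Summable f) (j : ℤ) (N : ℕ) :
    ∑ k ∈ Finset.range N, f (j + k) ≤ ∑' i, f i := by
  have hinj : Function.Injective (fun k : ℕ => j + (k : ℤ)) := fun a b h => by simpa using h
  have := Summable.sum_le_tsum (L := SummationFilter.unconditional ℤ) (f := f) ((Finset.range N).map ⟨_, hinj⟩) (fun i _ => h0 i) hf
  simpa using this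

/-- The contribution of a possibly singular term. -/
noncomputable def sing (b : ℝ) (y : ℝ) (i : ℤ) : ℝ :=
  |((b + i + y * I : ℂ)⁻¹).re| + |((b + i + 1 / 2 + y * I : ℂ)⁻¹).re|

/-- The singular terms cut off. -/
noncomputable def singCut (b : ℝ) (y : ℝ) (i : ℤ) : ℝ :=
  if i ∈ ({0, -1} : Finset ℤ) then sing b y i else 0

lemma singCut_nonneg (b y : ℝ) (i : ℤ) : 0 ≤ singCut b y i := by
  unfold singCut sing; split_ifs <;> positivity

lemma hasSum_singCut (b y : ℝ) : HasSum (singCut b y) (sing b y 0 + sing b y (-1)) := by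
  have := hasSum_sum_of_ne_finset_zero (L := SummationFilter.unconditional ℤ) (f := singCut b y) (s := {0, -1})
    (fun i hi => by simp only [singCut, if_neg hi])
  rw [Finset.sum_pair (by norm_num)] at this
  simpa [singCut] using this

lemma re_digTerm_le {w : ℂ} (k : ℕ) :
    |(digTerm k w).re| ≤ 8 * (1 / ((⌊w.re⌋ + k : ℤ) : ℝ) ^ 2)
      + singCut (Int.fract w.re) w.im (⌊w.re⌋ + k) := by
  set i : ℤ := ⌊w.re⌋ + k with hi
  have hre : w.re + k = Int.fract w.re + i := by
    rw [hi]; push_cast; linarith [Int.floor_add_fract w.re]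
  have b0 := Int.fract_nonneg w.re
  have b1 := Int.fract_lt_one w.re
  set b := Int.fract w.re with hb
  by_cases hmem : i ∈ ({0, -1} : Finset ℤ)
  · have h1 : w + k = b + i + w.im * I := by
      apply Complex.ext
      · simpa using hre
      · simp
    have h2 : w + k + 1 / 2 = b + i + 1 / 2 + w.im * I := by rw [h1]; ring
    have : |(digTerm k w).re| ≤ sing b w.im i := by
      unfold digTerm sing
      rw [h2, h1, Complex.sub_re]
      exact abs_sub _ _
    simp only [singCut, if_pos hmem]
    have : 0 ≤ 8 * (1 / (i : ℝ) ^ 2) := by positivity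
    linarith
  · simp only [singCut, if_neg hmem, add_zero]
    refine (Complex.abs_re_le_norm _).trans ?_
    simp only [Finset.mem_insert, Finset.mem_singleton, not_or] at hmem
    have hi0 : (i : ℝ) ≠ 0 := by exact_mod_cast hmem.1
    have hA : 0 < |(i : ℝ)| / 4 := by positivity
    have := norm_digTerm_le (k := k) (w := w) hA ?_ ?_
    · refine this.trans (le_of_eq ?_)
      rw [div_pow, sq_abs]; field_simp; norm_num
    all_goals
      rw [hre]
      rcases (by omega : (1 : ℤ) ≤ i ∨ i ≤ -2) with h | h
      · have h' : (1 : ℝ) ≤ i := by exact_mod_cast h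
        rw [abs_of_pos (by linarith : (0 : ℝ) < i), abs_of_pos (by linarith)]
        linarith
      · have h' : (i : ℝ) ≤ -2 := by exact_mod_cast h
        rw [abs_of_neg (by linarith : (i : ℝ) < 0), abs_of_neg (by linarith)]
        linarith

/-- The uniform constant. -/
noncomputable def unifC : ℝ := (∑' k : ℕ, (1 / 2 : ℝ) / ((k : ℝ) + 1) ^ 2)
  + ∑' i : ℤ, 8 * (1 / (i : ℝ) ^ 2)

lemma re_digDiff_le {w : ℂ} (hw : w.im ≠ 0) :
    |(digDiff w).re| ≤ unifC
      + (sing (Int.fract w.re) w.im 0 + sing (Int.fract w.re) w.im (-1)) := by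
  obtain ⟨N, hN⟩ := exists_nat_gt (1 - w.re)
  rw [digDiff_iter (noPole_of_im hw) (noPole_of_im (by simpa using hw)) N, Complex.add_re]
  have h1 : |(digDiff (w + N)).re| ≤ ∑' k : ℕ, (1 / 2 : ℝ) / ((k : ℝ) + 1) ^ 2 :=
    (Complex.abs_re_le_norm _).trans (norm_digDiff_le (by simp; linarith))
  have hs : Summable fun i : ℤ => 8 * (1 / (i : ℝ) ^ 2) :=
    (Real.summable_one_div_int_pow.2 one_lt_two).mul_left 8
  have h2 := sum_shift_le (f := fun i : ℤ => 8 * (1 / (i : ℝ) ^ 2))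
    (fun i => by positivity) hs ⌊w.re⌋ N
  have h3 := sum_shift_le (singCut_nonneg (Int.fract w.re) w.im)
    (hasSum_singCut _ _).summable ⌊w.re⌋ N
  rw [(hasSum_singCut _ _).tsum_eq] at h3
  have h4 : |(∑ k ∈ Finset.range N, digTerm k w).re| ≤ ∑ k ∈ Finset.range N,
      (8 * (1 / ((⌊w.re⌋ + k : ℤ) : ℝ) ^ 2)
      + singCut (Int.fract w.re) w.im (⌊w.re⌋ + k)) := by
    rw [Complex.re_sum]
    exact (Finset.abs_sum_le_sum_abs _ _).trans (Finset.sum_le_sum fun k _ => re_digTerm_le k)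
  rw [Finset.sum_add_distrib] at h4
  have := abs_add_le (∑ k ∈ Finset.range N, digTerm k w).re (digDiff (w + N)).re
  unfold unifC
  linarith

lemma poisson (d : ℝ) (T : ℝ) :
    IntervalIntegrable (fun t : ℝ => |((d + (t / 2 : ℝ) * I : ℂ)⁻¹).re|) MeasureTheory.volume
      T (T + 1) ∧
    ∫ t in T..(T + 1), |((d + (t / 2 : ℝ) * I : ℂ)⁻¹).re| ≤ 2 * Real.pi := by
  rcases eq_or_ne d 0 with rfl | hd
  · have : ∀ t : ℝ, |((((0 : ℝ) : ℂ) + (t / 2 : ℝ) * I : ℂ)⁻¹).re| = 0 := by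
      intro t; simp
    simp only [this]
    exact ⟨by simp, by simp; positivity⟩
  · have e : (fun t : ℝ => |((d + (t / 2 : ℝ) * I : ℂ)⁻¹).re|)
        = fun t : ℝ => |d|⁻¹ * (fun x : ℝ => (1 + x ^ 2)⁻¹) (t / (2 * d)) := by
      funext t
      have hn : Complex.normSq (d + (t / 2 : ℝ) * I) = d ^ 2 + (t / 2) ^ 2 := by
        rw [Complex.normSq_add_mul_I]
      rw [Complex.inv_re, hn]
      have hp : 0 < d ^ 2 + (t / 2) ^ 2 := by positivity
      have hr : ((d : ℂ) + (t / 2 : ℝ) * I).re = d := by simp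
      rw [hr, abs_div, abs_of_pos hp]
      have hd' : |d| ≠ 0 := abs_ne_zero.2 hd
      have h1 : 1 + (t / (2 * d)) ^ 2 = (d ^ 2 + (t / 2) ^ 2) / |d| ^ 2 := by
        rw [sq_abs]; field_simp
      simp only [h1]
      field_simp
    have hI : MeasureTheory.Integrable
        (fun t : ℝ => |d|⁻¹ * (fun x : ℝ => (1 + x ^ 2)⁻¹) (t / (2 * d))) :=
      (integrable_inv_one_add_sq.comp_div (by simpa using hd)).const_mul _
    rw [e]
    refine ⟨hI.intervalIntegrable, ?_⟩
    rw [intervalIntegral.integral_of_le (by linarith)]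
    refine (MeasureTheory.setIntegral_le_integral hI
      (Filter.Eventually.of_forall fun t => by simp only [Pi.zero_apply]; positivity)).trans ?_
    rw [MeasureTheory.integral_const_mul, MeasureTheory.Measure.integral_comp_div (fun x : ℝ => (1 + x ^ 2)⁻¹) (2 * d),
      integral_univ_inv_one_add_sq, smul_eq_mul, abs_mul]
    have hd' : |d| ≠ 0 := abs_ne_zero.2 hd
    apply le_of_eq
    field_simp
    norm_num

lemma sing_int (b : ℝ) (i : ℤ) (T : ℝ) :
    IntervalIntegrable (fun t : ℝ => sing b (t / 2) i) MeasureTheory.volume T (T + 1) ∧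
    ∫ t in T..(T + 1), sing b (t / 2) i ≤ 4 * Real.pi := by
  have p1 := poisson (b + i) T
  have p2 := poisson (b + i + 1 / 2) T
  push_cast at p1 p2
  unfold sing
  push_cast
  refine ⟨p1.1.add p2.1, ?_⟩
  rw [intervalIntegral.integral_add p1.1 p2.1]
  linarith [p1.2, p2.2]

lemma logDeriv_quot (α : ℝ) {s : ℂ} (hs : s.im ≠ 0) :
    logDeriv (fun s : ℂ => Complex.Gammaℝ (s + α) / Complex.Gammaℝ (s + 1 + α)) s
      = -(1 / 2) * digDiff ((s + α) / 2) := by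
  have hpi : (Real.pi : ℂ) ≠ 0 := by exact_mod_cast Real.pi_ne_zero
  have hc : ((Real.pi : ℂ) ^ (1 / 2 : ℂ)) ≠ 0 := by simp [Complex.cpow_eq_zero_iff, hpi]
  have e : (fun s : ℂ => Complex.Gammaℝ (s + α) / Complex.Gammaℝ (s + 1 + α))
      = fun s : ℂ => (Real.pi : ℂ) ^ (1 / 2 : ℂ) *
        (Gamma ((s + α) / 2) / Gamma ((s + α) / 2 + 1 / 2)) := by
    funext s
    rw [Complex.Gammaℝ_def, Complex.Gammaℝ_def,
      show -(s + α) / 2 = -(s + 1 + α) / 2 + 1 / 2 by ring, Complex.cpow_add _ _ hpi,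
      show (s + 1 + α) / 2 = (s + α) / 2 + 1 / 2 by ring]
    have : (Real.pi : ℂ) ^ (-(s + 1 + α) / 2) ≠ 0 := by simp [Complex.cpow_eq_zero_iff, hpi]
    rw [mul_assoc, mul_div_mul_left _ _ this, mul_div_assoc]
  have n1 : NoPole ((s + α) / 2) := noPole_of_im (by simpa using hs)
  have n2 : NoPole ((s + α) / 2 + 1 / 2) := noPole_of_im (by simpa using hs)
  have l1 : HasDerivAt (fun s : ℂ => (s + α) / 2) (1 / 2) s :=
    ((hasDerivAt_id s).add_const _).div_const 2
  have l2 : HasDerivAt (fun s : ℂ => (s + α) / 2 + 1 / 2) (1 / 2) s := l1.add_const _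
  have d1 := differentiableAt_Gamma _ n1
  have d2 := differentiableAt_Gamma _ n2
  rw [e, logDeriv_const_mul _ _ hc,
    logDeriv_div (f := fun s : ℂ => Gamma ((s + α) / 2))
      (g := fun s : ℂ => Gamma ((s + α) / 2 + 1 / 2)) s (Gamma_ne_zero n1) (Gamma_ne_zero n2)
      (DifferentiableAt.comp (f := fun s : ℂ => (s + α) / 2) s d1 l1.differentiableAt) 
      (DifferentiableAt.comp (f := fun s : ℂ => (s + α) / 2 + 1 / 2) s d2 l2.differentiableAt)]
  have c1 := logDeriv_comp (g := fun s : ℂ => (s + α) / 2) d1 l1.differentiableAt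
  have c2 := logDeriv_comp (g := fun s : ℂ => (s + α) / 2 + 1 / 2) d2 l2.differentiableAt
  rw [l1.deriv] at c1
  rw [l2.deriv] at c2
  simp only [Function.comp_def] at c1 c2
  rw [c1, c2]
  unfold digDiff digamma
  ring

theorem integral_abs_re_logDeriv_gammaR_quotient_bounded :
    ∃ C : ℝ, 0 < C ∧ ∀ (α T : ℝ),
      (fun g : ℂ → ℂ =>
        ∫ t in T..(T + 1),
          |((deriv g (Complex.I * (t : ℂ)) / g (Complex.I * (t : ℂ))).re)| ≤ C)
      (fun s => Complex.Gammaℝ (s + α) / Complex.Gammaℝ (s + 1 + α)) := by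
  have hC0 : 0 ≤ unifC := by
    unfold unifC
    exact add_nonneg (tsum_nonneg fun k => by positivity) (tsum_nonneg fun k => by positivity)
  refine ⟨unifC + 8 * Real.pi, by positivity, fun α T => ?_⟩
  beta_reduce
  set b := Int.fract (α / 2) with hb
  obtain ⟨i1, v1⟩ := sing_int b 0 T
  obtain ⟨i2, v2⟩ := sing_int b (-1) T
  have ic : IntervalIntegrable (fun _ : ℝ => unifC) MeasureTheory.volume T (T + 1) := by simp
  have hv : ∫ t in T..(T + 1), (unifC + (sing b (t / 2) 0 + sing b (t / 2) (-1)))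
      ≤ unifC + 8 * Real.pi := by
    rw [intervalIntegral.integral_add ic (i1.add i2), intervalIntegral.integral_add i1 i2]
    simp
    linarith
  refine le_trans ?_ hv
  have hI := (intervalIntegrable_iff_integrableOn_Ioc_of_le (by linarith)).1 (ic.add (i1.add i2))
  rw [intervalIntegral.integral_of_le (by linarith), intervalIntegral.integral_of_le (by linarith)]
  refine MeasureTheory.integral_mono_of_nonneg
    (Filter.Eventually.of_forall fun t => abs_nonneg _) hI ?_
  filter_upwards [MeasureTheory.Measure.ae_ne _ (0 : ℝ)] with t ht
  have := logDeriv_quot α (s := I * t) (by simpa using ht)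
  rw [logDeriv_apply] at this
  rw [this]
  have h := re_digDiff_le (w := (I * t + α) / 2) (by simpa using ht)
  have hr : ((I * t + α) / 2 : ℂ).re = α / 2 := by simp
  have hi : ((I * t + α) / 2 : ℂ).im = t / 2 := by simp
  rw [hr, hi, ← hb] at h
  have h2 : (-(1 / 2) * digDiff ((I * t + α) / 2)).re
      = -(1 / 2) * (digDiff ((I * t + α) / 2)).re := by
    have : (-(1 / 2) : ℂ) = ((-(1 / 2) : ℝ) : ℂ) := by push_cast; rfl
    rw [this, Complex.re_ofReal_mul]
  rw [h2, abs_mul]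
  have h3 : |(-(1 / 2) : ℝ)| = 1 / 2 := by rw [abs_neg, abs_of_pos] <;> norm_num
  rw [h3]
  have := abs_nonneg (digDiff ((I * t + α) / 2)).re
  linarith
end
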